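/- arXiv:2512.13537 — 2 statements merged into one kernel-verified Lean document; each statement's English description precedes it below -/
import Mathlib

section
/- Define the effective step size η_k = η r_{k+1} / F_k. Then for every N ≥ 1 the gAEGD iterates satisfy ∑_{k=0}^{N−1} η_k (1 − L η_k / 2) ‖∇f(x_k)‖^2 ≤ f(x_0) − f*. -/
/-- Descent lemma: a function with `L`-Lipschitz gradient lies below its quadratic upper model. -/
theorem le_add_inner_gradient_add_sq {E : Type*} [NormedAddCommGroup E] [InnerProductSpace ℝ E]
    [CompleteSpace E] {f : E → ℝ} (hf : Differentiable ℝ f) {L : ℝ}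
    (hLip : ∀ y z, ‖gradient f y - gradient f z‖ ≤ L * ‖y - z‖) (y v : E) :
    f (y + v) ≤ f y + inner ℝ (gradient f y) v + L / 2 * ‖v‖ ^ 2 := by
  have hφ (s : ℝ) :
      HasDerivAt (fun s : ℝ => f (y + s • v)) (inner ℝ (gradient f (y + s • v)) v) s := by
    have hline : HasDerivAt (fun s : ℝ => y + s • v) v s := by
      simpa using ((hasDerivAt_id s).smul_const v).const_add y
    have hcomp := (hf (y + s • v)).hasGradientAt.hasFDerivAt.comp_hasDerivAt s hline
    simpa [Function.comp_def] using hcomp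
  have hB (s : ℝ) :
      HasDerivAt (fun s : ℝ => f y + s * inner ℝ (gradient f y) v + L / 2 * ‖v‖ ^ 2 * s ^ 2)
        (inner ℝ (gradient f y) v + L * s * ‖v‖ ^ 2) s := by
    refine ((((hasDerivAt_id' s).mul_const (inner ℝ (gradient f y) v)).const_add (f y)).add
      ((hasDerivAt_pow 2 s).const_mul (L / 2 * ‖v‖ ^ 2))).congr_deriv ?_
    push_cast
    ring
  have key := image_le_of_deriv_right_le_deriv_boundary (a := 0) (b := 1)
    (fun s _ => (hφ s).continuousAt.continuousWithinAt) (fun s _ => (hφ s).hasDerivWithinAt)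
    (by simp) (fun s _ => (hB s).continuousAt.continuousWithinAt)
    (fun s _ => (hB s).hasDerivWithinAt)
    (fun s hs => by
      have hgrad : ‖gradient f (y + s • v) - gradient f y‖ ≤ L * (s * ‖v‖) := by
        simpa [norm_smul, abs_of_nonneg hs.1] using hLip (y + s • v) y
      have hinner := real_inner_le_norm (gradient f (y + s • v) - gradient f y) v
      rw [inner_sub_left] at hinner
      nlinarith [mul_le_mul_of_nonneg_right hgrad (norm_nonneg v)])
    (Set.right_mem_Icc.mpr zero_le_one)
  simpa using key

/-- One gradient step of size `t` decreases `f` by at least `t * (1 - L * t / 2) * ‖∇f(y)‖ ^ 2`. -/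
theorem gradient_step_descent {E : Type*} [NormedAddCommGroup E] [InnerProductSpace ℝ E]
    [CompleteSpace E] {f : E → ℝ} (hf : Differentiable ℝ f) {L : ℝ}
    (hLip : ∀ y z, ‖gradient f y - gradient f z‖ ≤ L * ‖y - z‖) (y : E) (t : ℝ) :
    t * (1 - L * t / 2) * ‖gradient f y‖ ^ 2 ≤ f y - f (y - t • gradient f y) := by
  have h := le_add_inner_gradient_add_sq hf hLip y (-(t • gradient f y))
  rw [← sub_eq_add_neg, inner_neg_right, real_inner_smul_right, real_inner_self_eq_norm_sq,
    norm_neg, norm_smul, mul_pow, Real.norm_eq_abs, sq_abs] at h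
  linarith

open Finset in
/-- Summed descent bound: with effective step size `η_k = η r_{k+1}/F_k`, for every `N ≥ 1`,
`∑_{k=0}^{N−1} η_k (1 − L η_k/2) ‖∇f(x_k)‖^2 ≤ f(x_0) − f*`. -/
theorem gAEGD_summed_descent_bound
    {d : ℕ} (hd : 1 ≤ d)
    (f : EuclideanSpace ℝ (Fin d) → ℝ) (hf : Differentiable ℝ f)
    (L : ℝ) (hL : 0 < L)
    (hLip : ∀ y z, ‖gradient f y - gradient f z‖ ≤ L * ‖y - z‖)
    (fstar : ℝ) (hfstar : IsGLB (Set.range f) fstar)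
    (Fhat : ℝ → ℝ) (hFdiff : Differentiable ℝ Fhat)
    (hFmono : StrictMonoOn Fhat (Set.Ioi (0 : ℝ)))
    (hFconc : ConcaveOn ℝ (Set.Ioi (0 : ℝ)) Fhat)
    (hFpos : ∀ s : ℝ, 0 < s → 0 < Fhat s)
    (hF'pos : ∀ s : ℝ, 0 < s → 0 < deriv Fhat s)
    (c : ℝ) (hc : 0 < fstar + c)
    (η : ℝ) (hη : 0 < η)
    (x : ℕ → EuclideanSpace ℝ (Fin d)) (r : ℕ → ℝ)
    (hr0 : 0 < r 0)
    (hrec_r : ∀ k : ℕ, r (k + 1) = r k /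
      (1 + η * (deriv Fhat (f (x k) + c) / Fhat (f (x k) + c)) * ‖gradient f (x k)‖ ^ 2))
    (hrec_x : ∀ k : ℕ, x (k + 1) =
      x k - (η * (r (k + 1) / Fhat (f (x k) + c))) • gradient f (x k)) :
    ∀ N : ℕ, 1 ≤ N →
      ∑ k ∈ Finset.range N,
        (η * (r (k + 1) / Fhat (f (x k) + c)))
          * (1 - L * (η * (r (k + 1) / Fhat (f (x k) + c))) / 2)
          * ‖gradient f (x k)‖ ^ 2
      ≤ f (x 0) - fstar := by
  intro N _
  calc _ ≤ ∑ k ∈ Finset.range N, (f (x k) - f (x (k + 1))) :=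
        Finset.sum_le_sum fun k _ => by
          rw [hrec_x k]
          exact gradient_step_descent hf hLip _ _
    _ = f (x 0) - f (x N) := Finset.sum_range_sub' (fun k => f (x k)) N
    _ ≤ f (x 0) - fstar := sub_le_sub_left (hfstar.1 ⟨x N, rfl⟩) _
end

section
/- Set F* = F̂(f* + c) and η_{r_0} = 4 F* (r_0 − F_0 + F*) / (L r_0^2). If r_0 > F_0 − F* and η < η_{r_0}, then for every k ≥ 0 the gAEGD energies satisfy r_k ≥ (L r_0^2 / (4 F*)) (η_{r_0} − η) > 0; in particular inf_k r_k > 0. -/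
/-- The descent lemma for functions with Lipschitz gradient. -/
theorem le_add_inner_gradient_add_of_lipschitz_gradient
    {E : Type*} [NormedAddCommGroup E] [InnerProductSpace ℝ E] [CompleteSpace E]
    {f : E → ℝ} (hf : Differentiable ℝ f) {L : ℝ}
    (hLip : ∀ y z, ‖gradient f y - gradient f z‖ ≤ L * ‖y - z‖) (x v : E) :
    f (x + v) ≤ f x + inner ℝ (gradient f x) v + L / 2 * ‖v‖ ^ 2 := by
  have hline (t : ℝ) : HasDerivAt (fun t : ℝ => x + t • v) v t := by
    simpa using ((hasDerivAt_id t).smul_const v).const_add x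
  have hcomp (t : ℝ) :
      HasDerivAt (fun t : ℝ => f (x + t • v)) (inner ℝ (gradient f (x + t • v)) v) t := by
    have h := (hf (x + t • v)).hasGradientAt.hasFDerivAt.comp_hasDerivAt t (hline t)
    rwa [InnerProductSpace.toDual_apply_apply] at h
  have hφ (t : ℝ) : HasDerivAt
      (fun t : ℝ => f (x + t • v) - t * inner ℝ (gradient f x) v - L / 2 * ‖v‖ ^ 2 * t ^ 2)
      (inner ℝ (gradient f (x + t • v)) v - inner ℝ (gradient f x) v - L * ‖v‖ ^ 2 * t) t := by
    have h := ((hcomp t).sub ((hasDerivAt_id t).mul_const (inner ℝ (gradient f x) v))).sub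
      ((hasDerivAt_pow 2 t).const_mul (L / 2 * ‖v‖ ^ 2))
    refine h.congr_deriv ?_
    push_cast
    ring
  have hanti := antitoneOn_of_deriv_nonpos (convex_Icc (0 : ℝ) 1)
    (fun t _ => (hφ t).continuousAt.continuousWithinAt)
    (fun t _ => (hφ t).differentiableAt.differentiableWithinAt) (fun t ht => by
      rw [(hφ t).deriv, ← inner_sub_left]
      have ht0 : 0 ≤ t := (interior_subset ht).1
      have hgrad := hLip (x + t • v) x
      rw [add_sub_cancel_left, norm_smul, Real.norm_of_nonneg ht0] at hgrad
      have hinner := real_inner_le_norm (gradient f (x + t • v) - gradient f x) v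
      nlinarith [mul_le_mul_of_nonneg_right hgrad (norm_nonneg v)])
  have h := hanti (Set.left_mem_Icc.2 zero_le_one) (Set.right_mem_Icc.2 zero_le_one) zero_le_one
  simp only [one_smul, zero_smul, add_zero, one_mul, zero_mul, one_pow, mul_one, sub_zero,
    ne_eq, OfNat.ofNat_ne_zero, not_false_eq_true, zero_pow, mul_zero] at h
  linarith

/-- A concave function lies below its tangent lines. -/
theorem ConcaveOn.le_add_deriv_mul_sub {S : Set ℝ} {g : ℝ → ℝ} (hg : ConcaveOn ℝ S g) {a b : ℝ}
    (ha : a ∈ S) (hb : b ∈ S) (hd : DifferentiableAt ℝ g a) :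
    g b ≤ g a + deriv g a * (b - a) := by
  rcases lt_trichotomy a b with h | rfl | h
  · have hs := hg.slope_le_deriv ha hb h hd
    rw [slope_def_field, div_le_iff₀ (sub_pos.2 h)] at hs
    linarith
  · simp
  · have hs := hg.deriv_le_slope hb ha h hd
    rw [slope_def_field, le_div_iff₀ (sub_pos.2 h)] at hs
    linarith

/-- The scalar inequality behind one step of gAEGD. -/
theorem sub_le_sub_add_sq_sub_sq_of_energy_step {L η Fs F F' G Fn r s : ℝ} (hL : 0 < L)
    (hη : 0 < η) (hFs : 0 < Fs) (hF : Fs ≤ F) (hF' : 0 < F') (hG : 0 ≤ G) (hr : 0 < r)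
    (hs : s = r / (1 + η * (F' / F) * G))
    (hFn : Fn ≤ F + F' * (-(η * (s / F)) * G + L / 2 * ((η * (s / F)) ^ 2 * G))) :
    Fn - F ≤ s - r + L * η / (4 * Fs) * (r ^ 2 - s ^ 2) := by
  have hFpos : 0 < F := hFs.trans_le hF
  have hden : 0 < 1 + η * (F' / F) * G := by positivity
  have hspos : 0 < s := hs ▸ div_pos hr hden
  have hrs : η * (s / F) * F' * G = r - s := by
    have h : s * (1 + η * (F' / F) * G) = r := by rw [hs]; field_simp
    rw [← h]
    ring
  have hdiff : 0 ≤ r - s := by rw [← hrs]; positivity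
  have hquot : s / F ≤ s / Fs := by gcongr
  calc Fn - F ≤ -(r - s) + L * η / 2 * (s / F * (r - s)) := by
        rw [← hrs]
        linarith
    _ ≤ -(r - s) + L * η / 2 * (s / Fs * (r - s)) := by gcongr
    _ = s - r + L * η / (4 * Fs) * (2 * s * (r - s)) := by field_simp; ring
    _ ≤ s - r + L * η / (4 * Fs) * (r ^ 2 - s ^ 2) := by
        gcongr
        nlinarith [sq_nonneg (r - s)]

/-- Positive lower bound on energies: with `F* = F̂(f* + c)` and
`η_{r_0} = 4F*(r_0 − F_0 + F*)/(L r_0^2)`, if `r_0 > F_0 − F*` and `η < η_{r_0}`, then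
`r_k ≥ (L r_0^2/(4F*)) (η_{r_0} − η) > 0` for all `k`; in particular `inf_k r_k > 0`. -/
theorem gAEGD_energy_lower_bound
    {d : ℕ} (hd : 1 ≤ d)
    (f : EuclideanSpace ℝ (Fin d) → ℝ) (hf : Differentiable ℝ f)
    (L : ℝ) (hL : 0 < L)
    (hLip : ∀ y z, ‖gradient f y - gradient f z‖ ≤ L * ‖y - z‖)
    (fstar : ℝ) (hfstar : IsGLB (Set.range f) fstar)
    (Fhat : ℝ → ℝ) (hFdiff : Differentiable ℝ Fhat)
    (hFmono : StrictMonoOn Fhat (Set.Ioi (0 : ℝ)))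
    (hFconc : ConcaveOn ℝ (Set.Ioi (0 : ℝ)) Fhat)
    (hFpos : ∀ s : ℝ, 0 < s → 0 < Fhat s)
    (hF'pos : ∀ s : ℝ, 0 < s → 0 < deriv Fhat s)
    (c : ℝ) (hc : 0 < fstar + c)
    (η : ℝ) (hη : 0 < η)
    (x : ℕ → EuclideanSpace ℝ (Fin d)) (r : ℕ → ℝ)
    (hr0 : 0 < r 0)
    (hrec_r : ∀ k : ℕ, r (k + 1) = r k /
      (1 + η * (deriv Fhat (f (x k) + c) / Fhat (f (x k) + c)) * ‖gradient f (x k)‖ ^ 2))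
    (hrec_x : ∀ k : ℕ, x (k + 1) =
      x k - (η * (r (k + 1) / Fhat (f (x k) + c))) • gradient f (x k))
    (ηr0 : ℝ)
    (hηr0 : ηr0 = 4 * Fhat (fstar + c) * (r 0 - Fhat (f (x 0) + c) + Fhat (fstar + c))
      / (L * (r 0) ^ 2))
    (h1 : Fhat (f (x 0) + c) - Fhat (fstar + c) < r 0)
    (h2 : η < ηr0) :
    (∀ k : ℕ, (L * (r 0) ^ 2 / (4 * Fhat (fstar + c))) * (ηr0 - η) ≤ r k) ∧
    0 < (L * (r 0) ^ 2 / (4 * Fhat (fstar + c))) * (ηr0 - η) ∧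
    0 < ⨅ k : ℕ, r k := by
  have harg (y) : 0 < f y + c := by linarith [hfstar.1 (Set.mem_range_self y)]
  have hFs : 0 < Fhat (fstar + c) := hFpos _ hc
  have hFle (y) : Fhat (fstar + c) ≤ Fhat (f y + c) :=
    hFmono.monotoneOn hc (harg y) (by linarith [hfstar.1 (Set.mem_range_self y)])
  have hrpos (k : ℕ) : 0 < r k := by
    induction k with
    | zero => exact hr0
    | succ k ih =>
      rw [hrec_r]
      have := hFpos _ (harg (x k))
      have := hF'pos _ (harg (x k))
      positivity
  have hstep (k : ℕ) : Fhat (f (x (k + 1)) + c) - Fhat (f (x k) + c) ≤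
      r (k + 1) - r k + L * η / (4 * Fhat (fstar + c)) * (r k ^ 2 - r (k + 1) ^ 2) := by
    refine sub_le_sub_add_sq_sub_sq_of_energy_step hL hη hFs (hFle _) (hF'pos _ (harg (x k)))
      (sq_nonneg _) (hrpos k) (hrec_r k) ?_
    have hdescent := le_add_inner_gradient_add_of_lipschitz_gradient hf hLip (x k)
      (-((η * (r (k + 1) / Fhat (f (x k) + c))) • gradient f (x k)))
    rw [← sub_eq_add_neg, ← hrec_x, norm_neg, norm_smul, mul_pow, Real.norm_eq_abs, sq_abs,
      inner_neg_right, inner_smul_right, real_inner_self_eq_norm_sq] at hdescent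
    refine (hFconc.le_add_deriv_mul_sub (harg (x k)) (harg (x (k + 1))) (hFdiff _)).trans ?_
    gcongr
    · exact (hF'pos _ (harg (x k))).le
    · linarith
  have hsum (k : ℕ) : Fhat (f (x k) + c) - Fhat (f (x 0) + c) ≤
      r k - r 0 + L * η / (4 * Fhat (fstar + c)) * (r 0 ^ 2 - r k ^ 2) := by
    induction k with
    | zero => simp
    | succ k ih => linarith [hstep k]
  have hbound : L * r 0 ^ 2 / (4 * Fhat (fstar + c)) * (ηr0 - η) =
      r 0 - Fhat (f (x 0) + c) + Fhat (fstar + c)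
        - L * η / (4 * Fhat (fstar + c)) * r 0 ^ 2 := by
    rw [hηr0]
    field_simp
  have hlower (k : ℕ) : L * r 0 ^ 2 / (4 * Fhat (fstar + c)) * (ηr0 - η) ≤ r k := by
    have hsq : 0 ≤ L * η / (4 * Fhat (fstar + c)) * r k ^ 2 := by positivity
    linarith [hsum k, hFle (x k)]
  have hpos : 0 < L * r 0 ^ 2 / (4 * Fhat (fstar + c)) * (ηr0 - η) :=
    mul_pos (by positivity) (sub_pos.2 h2)
  exact ⟨hlower, hpos, hpos.trans_le (le_ciInf hlower)⟩
end
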